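/- Assume the system is AG EF terminating, and let P be a set of states (the progress states). Then there exists a reachable state from which no state in P is reachable if and only if there exists a reachable terminal state that is not in P. -/

import Mathlib

/-- `TPath step s σ s'` means `s →[σ] s'`: firing the sequence `σ` of transitions
from `s` yields `s'`. -/
inductive TPath {S T : Type*} (step : S → T → S → Prop) : S → List T → S → Prop
  | nil (s : S) : TPath step s [] s
  | cons {s s' s'' : S} {t : T} {σ : List T} :
      step s t s' → TPath step s' σ s'' → TPath step s (t :: σ) s''

/-- Transition `t` is enabled at `s`. -/
def Enabled {S T : Type*} (step : S → T → S → Prop) (s : S) (t : T) : Prop :=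
  ∃ s', step s t s'

/-- A state is terminal iff no transition is enabled at it. -/
def Terminal {S T : Type*} (step : S → T → S → Prop) (s : S) : Prop :=
  ∀ t, ¬ Enabled step s t

/-- `s'` is reachable from `s`. -/
def Reachable {S T : Type*} (step : S → T → S → Prop) (s s' : S) : Prop :=
  ∃ σ, TPath step s σ s'

/-- An r-edge: a step `s →[t] s'` with `t ∈ 𝒯 s`. -/
def REdge {S T : Type*} (step : S → T → S → Prop) (𝒯 : S → Set T)
    (s : S) (t : T) (s' : S) : Prop :=
  step s t s' ∧ t ∈ 𝒯 s

/-- The transition relation is deterministic. -/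
def Deterministic {S T : Type*} (step : S → T → S → Prop) : Prop :=
  ∀ s t s₁ s₂, step s t s₁ → step s t s₂ → s₁ = s₂

/-- D0: if `s₀` is not terminal then `𝒯 s₀` contains an enabled transition. -/
def D0 {S T : Type*} (step : S → T → S → Prop) (𝒯 : S → Set T) : Prop :=
  ∀ s₀, ¬ Terminal step s₀ → ∃ t ∈ 𝒯 s₀, Enabled step s₀ t

/-- D1: if `t ∈ 𝒯 s₀`, `t₁,…,tₙ ∉ 𝒯 s₀` and `s₀ →[t₁⋯tₙ t] s'`
then `s₀ →[t t₁⋯tₙ] s'`. -/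
def D1 {S T : Type*} (step : S → T → S → Prop) (𝒯 : S → Set T) : Prop :=
  ∀ s₀ t σ s', t ∈ 𝒯 s₀ → (∀ u ∈ σ, u ∉ 𝒯 s₀) →
    TPath step s₀ (σ ++ [t]) s' → TPath step s₀ (t :: σ) s'

/-- D2: if `t ∈ 𝒯 s₀` is enabled at `s₀`, `t₁,…,tₙ ∉ 𝒯 s₀` and `s₀ →[t₁⋯tₙ] sₙ`
then `t` is enabled at `sₙ`. -/
def D2 {S T : Type*} (step : S → T → S → Prop) (𝒯 : S → Set T) : Prop :=
  ∀ s₀ t σ sₙ, t ∈ 𝒯 s₀ → Enabled step s₀ t → (∀ u ∈ σ, u ∉ 𝒯 s₀) →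
    TPath step s₀ σ sₙ → Enabled step sₙ t

theorem TPath.append {S T : Type*} {step : S → T → S → Prop} {s s' s'' : S} {σ τ : List T}
    (h : TPath step s σ s') (h' : TPath step s' τ s'') : TPath step s (σ ++ τ) s'' := by
  induction h with
  | nil => exact h'
  | cons hstep _ ih => exact .cons hstep (ih h')

theorem Reachable.refl {S T : Type*} (step : S → T → S → Prop) (s : S) : Reachable step s s :=
  ⟨[], .nil s⟩

theorem Reachable.trans {S T : Type*} {step : S → T → S → Prop} {s s' s'' : S}
    (h : Reachable step s s') (h' : Reachable step s' s'') : Reachable step s s'' :=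
  let ⟨σ, hσ⟩ := h
  let ⟨τ, hτ⟩ := h'
  ⟨σ ++ τ, hσ.append hτ⟩

theorem Terminal.eq_of_reachable {S T : Type*} {step : S → T → S → Prop} {s s' : S}
    (hs : Terminal step s) (h : Reachable step s s') : s' = s := by
  obtain ⟨_, h⟩ := h
  cases h with
  | nil => rfl
  | cons hstep _ => exact absurd ⟨_, hstep⟩ (hs _)

/-- Theorem 4 (first claim): assuming the system is AG EF terminating, the full
state space contains a state from which no progress state is reachable iff it
contains a terminal state that is not a progress state. -/
theorem stmt11 {S T : Type*} (step : S → T → S → Prop) (sHat : S)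
    (hdet : Deterministic step)
    (hAGEF : ∀ s, Reachable step sHat s →
      ∃ s_t, Terminal step s_t ∧ Reachable step s s_t)
    (P : Set S) :
    (∃ s, Reachable step sHat s ∧ ∀ p ∈ P, ¬ Reachable step s p) ↔
      (∃ s, Reachable step sHat s ∧ Terminal step s ∧ s ∉ P) := by
  constructor
  · rintro ⟨s, hs, hP⟩
    obtain ⟨s_t, hterm, hst⟩ := hAGEF s hs
    exact ⟨s_t, hs.trans hst, hterm, fun hp => hP s_t hp hst⟩
  · rintro ⟨s, hs, hterm, hsP⟩
    exact ⟨s, hs, fun p hp hr => hsP (hterm.eq_of_reachable hr ▸ hp)⟩
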